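/- arXiv:1412.5569 — 5 statements merged into one kernel-verified Lean document; each statement's English description precedes it below -/
import Mathlib

section
/- Let F be a finite field, let L be a collection of k-planes in F^n, and let d be an integer with k ≤ d ≤ n. Then there exist an integer m with k ≤ m ≤ d, m-planes R_1, …, R_N in F^n, and collections of k-planes L_{R_1}, …, L_{R_N} such that: (a) the L_{R_j} are pairwise disjoint subsets of L, and every L' ∈ L_{R_j} satisfies L' ⊆ R_j; (b) if m > k then |L_{R_j}| ≥ |F|^{(k+1)(m-1-k)+k} for every j; (c) if m = k then |L_{R_j}| = 1 for every j; (d) the set L^m := ⋃_j L_{R_j} satisfies |L^m| ≥ 2^{-(d-m+1)} |L|; (e) for every integer m' with m < m' ≤ d and every m'-plane S ⊂ F^n, the number of k-planes of L^m contained in S is strictly less than |F|^{(k+1)(m'-1-k)+k}. -/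
open scoped Pointwise

/-- `A` is a `k`-plane (i.e. a `k`-dimensional affine subspace) of the `F`-vector space `V`. -/
def IsPlane (F : Type*) [Field F] {V : Type*} [AddCommGroup V] [Module F V]
    (k : ℕ) (A : Set V) : Prop :=
  ∃ (x : V) (W : Submodule F V), Module.finrank F W = k ∧ A = x +ᵥ (W : Set V)

/-- Greedy extraction: a family `M` of sets contains disjoint subfamilies of size at least `T`, each
contained in a member of the class `P`, such that afterwards no member of `P` contains `T` or more
of the remaining sets. -/
theorem exists_greedy_extraction {V : Type*} [Finite V] (P : Set V → Prop) {T : ℕ} (hT : 0 < T)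
    (M : Set (Set V)) :
    ∃ (N : ℕ) (R : Fin N → Set V) (LR : Fin N → Set (Set V)),
      (∀ j, P (R j)) ∧ (∀ i j, i ≠ j → Disjoint (LR i) (LR j)) ∧ (∀ j, LR j ⊆ M) ∧
      (∀ j, ∀ ℓ ∈ LR j, ℓ ⊆ R j) ∧ (∀ j, T ≤ (LR j).ncard) ∧
      ∀ S, P S → {ℓ ∈ M \ ⋃ j, LR j | ℓ ⊆ S}.ncard < T := by
  induction h : M.ncard using Nat.strong_induction_on generalizing M with
  | _ c ih =>
  subst h
  by_cases hM : ∀ S, P S → {ℓ ∈ M | ℓ ⊆ S}.ncard < T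
  · exact ⟨0, Fin.elim0, Fin.elim0, by simpa using hM⟩
  push Not at hM
  obtain ⟨S, hS, hTS⟩ := hM
  set A : Set (Set V) := {ℓ ∈ M | ℓ ⊆ S}
  have hAM : A ⊆ M := Set.sep_subset _ _
  have hlt : (M \ A).ncard < M.ncard := by
    have := Set.ncard_sdiff_add_ncard_of_subset hAM
    omega
  obtain ⟨N, R, LR, hR, hdisj, hsub, hin, hcard, hrest⟩ := ih _ hlt _ rfl
  have hA : ∀ j, Disjoint A (LR j) := fun j =>
    Set.disjoint_sdiff_right.mono_right (hsub j)
  refine ⟨N + 1, Fin.cons S R, Fin.cons A LR, ?_, ?_, ?_, ?_, ?_, ?_⟩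
  · simpa [Fin.forall_fin_succ] using ⟨hS, hR⟩
  · intro i j
    cases i using Fin.cases <;> cases j using Fin.cases
    · simp
    · exact fun _ => hA _
    · exact fun _ => (hA _).symm
    · simpa using hdisj _ _
  · simpa [Fin.forall_fin_succ] using ⟨hAM, fun j => (hsub j).trans Set.sdiff_subset⟩
  · simpa only [Fin.forall_fin_succ, Fin.cons_zero, Fin.cons_succ] using
      ⟨fun ℓ hℓ => hℓ.2, hin⟩
  · simpa [Fin.forall_fin_succ] using ⟨hTS, hcard⟩
  · have hU : (⋃ j, (Fin.cons A LR : Fin (N + 1) → Set (Set V)) j) = A ∪ ⋃ j, LR j := by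
      ext ℓ
      simp
    rw [hU, ← Set.sdiff_sdiff]
    exact hrest

/-- A finite family of sets is the disjoint union of singletons of its members. -/
theorem exists_fin_singletons {V : Type*} [Finite V] (M : Set (Set V)) :
    ∃ (N : ℕ) (R : Fin N → Set V), (∀ j, R j ∈ M) ∧ Function.Injective R ∧ (⋃ j, {R j}) = M := by
  obtain ⟨N, ⟨e⟩⟩ := Finite.exists_equiv_fin M
  refine ⟨N, fun j => e.symm j, fun j => (e.symm j).2,
    Subtype.val_injective.comp e.symm.injective, ?_⟩
  rw [Set.iUnion_singleton_eq_range]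
  exact (e.symm.surjective.range_comp Subtype.val).trans Subtype.range_coe

/-- **Lemma 2.1.** Extraction of plane-concentrated subfamilies. -/
theorem plane_selection_lemma (F : Type) [Field F] [Fintype F] (n k d : ℕ)
    (hkd : k ≤ d) (hdn : d ≤ n)
    (L : Set (Set (Fin n → F))) (hL : ∀ ℓ ∈ L, IsPlane F k ℓ) :
    ∃ m : ℕ, k ≤ m ∧ m ≤ d ∧
      ∃ (N : ℕ) (R : Fin N → Set (Fin n → F)) (LR : Fin N → Set (Set (Fin n → F))),
        (∀ j, IsPlane F m (R j)) ∧
        -- (a)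
        (∀ i j, i ≠ j → Disjoint (LR i) (LR j)) ∧
        (∀ j, LR j ⊆ L) ∧
        (∀ j, ∀ ℓ ∈ LR j, ℓ ⊆ R j) ∧
        -- (b)
        (k < m → ∀ j, Fintype.card F ^ ((k + 1) * (m - 1 - k) + k) ≤ (LR j).ncard) ∧
        -- (c)
        (m = k → ∀ j, (LR j).ncard = 1) ∧
        -- (d)
        ((L.ncard : ℝ) / 2 ^ (d - m + 1) ≤ ((⋃ j, LR j).ncard : ℝ)) ∧
        -- (e)
        (∀ m' : ℕ, m < m' → m' ≤ d → ∀ S : Set (Fin n → F), IsPlane F m' S →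
          {ℓ ∈ ⋃ j, LR j | ℓ ⊆ S}.ncard < Fintype.card F ^ ((k + 1) * (m' - 1 - k) + k)) := by
  set T : ℕ → ℕ := fun m => Fintype.card F ^ ((k + 1) * (m - 1 - k) + k)
  have hT : ∀ m, 0 < T m := fun m => pow_pos Fintype.card_pos _
  obtain ⟨s, hsd, M, hML, hcard, hsparse⟩ : ∃ s, k + s ≤ d ∧ ∃ M ⊆ L,
      (L.ncard : ℝ) / 2 ^ (d - (k + s)) ≤ M.ncard ∧
      ∀ m', k + s < m' → m' ≤ d → ∀ S : Set (Fin n → F), IsPlane F m' S →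
        {ℓ ∈ M | ℓ ⊆ S}.ncard < T m' := by
    obtain ⟨s, rfl⟩ := Nat.exists_eq_add_of_le hkd
    exact ⟨s, le_rfl, L, subset_rfl, by simp, by omega⟩
  induction s generalizing M with
  | zero =>
    obtain ⟨N, R, hRM, hinj, hU⟩ := exists_fin_singletons M
    refine ⟨k, le_rfl, hkd, N, R, fun j => {R j}, fun j => hL _ (hML (hRM j)), ?_, ?_, ?_,
      fun h => absurd h (lt_irrefl k), fun _ j => Set.ncard_singleton _, ?_, ?_⟩
    · exact fun i j hij => Set.disjoint_singleton.2 (hinj.ne hij)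
    · exact fun j => Set.singleton_subset_iff.2 (hML (hRM j))
    · rintro j ℓ rfl
      exact subset_rfl
    · rw [hU]
      refine le_trans ?_ hcard
      gcongr
      · norm_num
      · omega
    · rw [hU]
      exact hsparse
  | succ s ih =>
    obtain ⟨N, R, LR, hR, hdisj, hsub, hin, hTle, hrest⟩ :=
      exists_greedy_extraction (IsPlane F (k + (s + 1))) (hT (k + (s + 1))) M
    have hUM : (⋃ j, LR j) ⊆ M := Set.iUnion_subset hsub
    by_cases hhalf : (M.ncard : ℝ) / 2 ≤ (⋃ j, LR j).ncard
    · refine ⟨k + (s + 1), by omega, hsd, N, R, LR, hR, hdisj, fun j => (hsub j).trans hML, hin,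
        fun _ => hTle, by omega, ?_, ?_⟩
      · rw [pow_succ, ← div_div]
        linarith
      · intro m' hm hm' S hS
        refine (Set.ncard_le_ncard ?_).trans_lt (hsparse m' hm hm' S hS)
        exact fun ℓ hℓ => ⟨hUM hℓ.1, hℓ.2⟩
    · refine ih (by omega) (M \ ⋃ j, LR j) (Set.sdiff_subset.trans hML) ?_ ?_
      · have hsum : ((M \ ⋃ j, LR j).ncard : ℝ) + (⋃ j, LR j).ncard = M.ncard := by
          exact_mod_cast Set.ncard_sdiff_add_ncard_of_subset hUM
        have hexp : d - (k + s) = d - (k + (s + 1)) + 1 := by omega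
        rw [hexp, pow_succ, ← div_div]
        linarith
      · intro m' hm hm' S hS
        obtain rfl | hlt : m' = k + (s + 1) ∨ k + (s + 1) < m' := by omega
        · exact hrest S hS
        · refine (Set.ncard_le_ncard ?_).trans_lt (hsparse m' hlt hm' S hS)
          exact fun ℓ hℓ => ⟨hℓ.1.1, hℓ.2⟩
end

section
/- Let F be a finite field, let S be an m-plane in F^n, let k ≥ 1 and 0 ≤ q ≤ k-1 be integers, and suppose m + k - q ≤ n. Then there exist (m+k-q)-planes T_1, …, T_N in F^n, each containing S, such that for every (k-1)-plane P and every k-plane L in F^n satisfying (a) P ⊆ L, (b) L ∩ S is a q-plane, and (c) P ∩ S is a (q-1)-plane if q > 0, and P ∩ S = ∅ if q = 0, there is an index i with L ⊆ T_i, and for every i' ≠ i one has P ⊄ T_{i'}. -/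
open scoped Pointwise

open Module

section

variable {F : Type*} [Field F] {V : Type*} [AddCommGroup V] [Module F V]

theorem mem_vadd_submodule_iff {x y : V} {W : Submodule F V} :
    y ∈ x +ᵥ (W : Set V) ↔ y - x ∈ W := by
  rw [Set.mem_vadd_set_iff_neg_vadd_mem, vadd_eq_add, neg_add_eq_sub, SetLike.mem_coe]

theorem vadd_submodule_subset_iff {x : V} {W U : Submodule F V} :
    x +ᵥ (W : Set V) ⊆ x +ᵥ (U : Set V) ↔ W ≤ U := by
  rw [Set.vadd_set_subset_vadd_set_iff, SetLike.coe_subset_coe]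

theorem IsPlane.nonempty {k : ℕ} {A : Set V} (hA : IsPlane F k A) : A.Nonempty := by
  obtain ⟨x, W, -, rfl⟩ := hA
  exact ⟨x, by simp [mem_vadd_submodule_iff]⟩

theorem IsPlane.exists_eq_vadd {k : ℕ} {A : Set V} (hA : IsPlane F k A) {x : V} (hx : x ∈ A) :
    ∃ W : Submodule F V, finrank F W = k ∧ A = x +ᵥ (W : Set V) := by
  obtain ⟨a, W, hW, rfl⟩ := hA
  refine ⟨W, hW, Set.ext fun y => ?_⟩
  rw [mem_vadd_submodule_iff] at hx
  rw [mem_vadd_submodule_iff, mem_vadd_submodule_iff, ← W.sub_mem_iff_left hx]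
  simp

theorem IsPlane.dim_unique {k l : ℕ} {A : Set V} (hA : IsPlane F k A) (hA' : IsPlane F l A) :
    k = l := by
  obtain ⟨x, W, rfl, rfl⟩ := hA
  obtain ⟨U, rfl, hU⟩ := hA'.exists_eq_vadd (by simp [mem_vadd_submodule_iff] : x ∈ _)
  rw [le_antisymm (vadd_submodule_subset_iff.1 hU.subset)
    (vadd_submodule_subset_iff.1 hU.superset)]

variable [FiniteDimensional F V]

theorem IsPlane.eq_of_subset {k : ℕ} {A B : Set V} (hA : IsPlane F k A) (hB : IsPlane F k B)
    (hAB : A ⊆ B) : A = B := by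
  obtain ⟨x, W, hW, rfl⟩ := hA
  obtain ⟨U, hU, rfl⟩ := hB.exists_eq_vadd (hAB (by simp [mem_vadd_submodule_iff] : x ∈ _))
  rw [Submodule.eq_of_le_of_finrank_eq (vadd_submodule_subset_iff.1 hAB) (hW.trans hU.symm)]

/-- A plane containing a hyperplane `P` of `L` and a point of `L \ P` contains `L`. -/
theorem IsPlane.subset_of_hyperplane_subset {k d : ℕ} {P L T : Set V} (hP : IsPlane F k P)
    (hL : IsPlane F (k + 1) L) (hT : IsPlane F d T) (hPL : P ⊆ L) (hPT : P ⊆ T) {y : V}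
    (hyL : y ∈ L) (hyP : y ∉ P) (hyT : y ∈ T) : L ⊆ T := by
  obtain ⟨p, hp⟩ := hP.nonempty
  obtain ⟨W, hW, rfl⟩ := hP.exists_eq_vadd hp
  obtain ⟨X, hX, rfl⟩ := hL.exists_eq_vadd (hPL hp)
  obtain ⟨U, -, rfl⟩ := hT.exists_eq_vadd (hPT hp)
  rw [mem_vadd_submodule_iff] at hyL hyP hyT
  rw [vadd_submodule_subset_iff] at hPL hPT ⊢
  have hlt : W < W ⊔ F ∙ (y - p) := by
    rwa [left_lt_sup, Submodule.span_singleton_le_iff_mem]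
  have hle : W ⊔ F ∙ (y - p) ≤ X := sup_le hPL (by rwa [Submodule.span_singleton_le_iff_mem])
  have hfin := Submodule.finrank_lt_finrank_of_lt hlt
  rw [← Submodule.eq_of_le_of_finrank_le hle (by omega)]
  exact sup_le hPT (by rwa [Submodule.span_singleton_le_iff_mem])

/-- The join of two planes meeting in a `q`-plane: it is the least plane containing both. -/
theorem IsPlane.exists_join {k m q : ℕ} {L S : Set V} (hL : IsPlane F k L) (hS : IsPlane F m S)
    (hLS : IsPlane F q (L ∩ S)) :
    ∃ T, IsPlane F (m + k - q) T ∧ L ⊆ T ∧ S ⊆ T ∧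
      ∀ d T', IsPlane F d T' → L ⊆ T' → S ⊆ T' → T ⊆ T' := by
  obtain ⟨z, hzL, hzS⟩ := hLS.nonempty
  obtain ⟨X, rfl, rfl⟩ := hL.exists_eq_vadd hzL
  obtain ⟨W, rfl, rfl⟩ := hS.exists_eq_vadd hzS
  rw [← Set.vadd_set_inter, ← Submodule.coe_inf] at hLS
  have hq : finrank F ↥(X ⊓ W) = q :=
    IsPlane.dim_unique ⟨z, _, rfl, rfl⟩ hLS
  have hsup := Submodule.finrank_sup_add_finrank_inf_eq X W
  refine ⟨z +ᵥ ((X ⊔ W : Submodule F V) : Set V), ⟨z, _, by omega, rfl⟩,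
    vadd_submodule_subset_iff.2 le_sup_left, vadd_submodule_subset_iff.2 le_sup_right, ?_⟩
  intro d T' hT' hLT hST
  obtain ⟨U, -, rfl⟩ := hT'.exists_eq_vadd (hLT hzL)
  rw [vadd_submodule_subset_iff] at *
  exact sup_le hLT hST

end

/-- **Lemma 2.2 (foliation).** -/
theorem foliation_lemma (F : Type) [Field F] [Fintype F] (n m k q : ℕ)
    (hk : 1 ≤ k) (hq : q ≤ k - 1) (hmn : m + k - q ≤ n)
    (S : Set (Fin n → F)) (hS : IsPlane F m S) :
    ∃ (N : ℕ) (T : Fin N → Set (Fin n → F)),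
      (∀ i, IsPlane F (m + k - q) (T i)) ∧
      (∀ i, S ⊆ T i) ∧
      ∀ P L : Set (Fin n → F),
        IsPlane F (k - 1) P → IsPlane F k L →
        -- (a)
        P ⊆ L →
        -- (b)
        IsPlane F q (L ∩ S) →
        -- (c)
        (0 < q → IsPlane F (q - 1) (P ∩ S)) →
        (q = 0 → P ∩ S = ∅) →
        ∃ i, L ⊆ T i ∧ ∀ i', i' ≠ i → ¬ P ⊆ T i' := by
  let e := Finite.equivFin {T : Set (Fin n → F) // IsPlane F (m + k - q) T ∧ S ⊆ T}
  refine ⟨_, fun i => (e.symm i).1, fun i => (e.symm i).2.1, fun i => (e.symm i).2.2, ?_⟩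
  intro P L hP hL hPL hLS hPS hPS₀
  obtain ⟨T, hT, hLT, hST, hmin⟩ := hL.exists_join hS hLS
  refine ⟨e ⟨T, hT, hST⟩, by simpa using hLT, fun i hi hPT => hi ?_⟩
  obtain ⟨hT', hST'⟩ := (e.symm i).2
  obtain ⟨y, ⟨hyL, hyS⟩, hyP⟩ : ∃ y ∈ L ∩ S, y ∉ P := by
    by_contra! h
    have heq : P ∩ S = L ∩ S :=
      (Set.inter_subset_inter_left S hPL).antisymm fun y hy => ⟨h y hy, hy.2⟩
    rcases Nat.eq_zero_or_pos q with hq₀ | hq₀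
    · exact hLS.nonempty.ne_empty (heq ▸ hPS₀ hq₀)
    · have := (hPS hq₀).dim_unique (heq ▸ hLS)
      omega
  have hLT' := hP.subset_of_hyperplane_subset (by rwa [Nat.sub_add_cancel hk]) hT' hPL hPT
    hyL hyP (hST' hyS)
  rw [← e.symm_apply_eq]
  exact Subtype.ext (hT.eq_of_subset hT' (hmin _ _ hT' hLT' hST')).symm
end

section
/- Let F be a finite field and let k ≤ m be positive integers. There exists a constant c > 0 depending only on k and m such that the following holds: if L is a collection of m-planes in F^n, P is a collection of (k-1)-planes in F^n, M > 0 is a real number such that every L' ∈ L contains at least M members of P, and |L| · |F|^{k(m-k)} ≤ M, then |P| ≥ c · |L| · M. -/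
open scoped Pointwise

/-- A family of sets of size at least `M` with small pairwise intersections has a large union. -/
theorem card_mul_le_of_card_inter_le {ι α : Type*} [DecidableEq ι] [DecidableEq α]
    (L : Finset ι) (A : ι → Finset α) (P : Finset α) {M D C : ℝ} (hM : 0 < M) (hC : 1 ≤ C)
    (hAP : ∀ i ∈ L, A i ⊆ P) (hA : ∀ i ∈ L, M ≤ (A i).card)
    (hD : ∀ i ∈ L, ∀ j ∈ L, i ≠ j → ((A i ∩ A j).card : ℝ) ≤ D)
    (hLD : L.card * D ≤ C * M) :
    L.card * M ≤ 4 * C * P.card := by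
  rcases L.eq_empty_or_nonempty with rfl | hne
  · simp only [Finset.card_empty, Nat.cast_zero, zero_mul]
    positivity
  have hL1 : 1 ≤ L.card := hne.card_pos
  have hL1' : (1 : ℝ) ≤ L.card := by exact_mod_cast hL1
  have hr : (0 : ℝ) ≤ L.card / (2 * C) := by positivity
  set r := ⌊(L.card : ℝ) / (2 * C)⌋₊
  have hr1 : (r : ℝ) ≤ L.card / (2 * C) := Nat.floor_le hr
  have hr2 : (L.card : ℝ) / (2 * C) < r + 1 := Nat.lt_floor_add_one _
  rw [le_div_iff₀ (by positivity)] at hr1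
  rw [div_lt_iff₀ (by positivity)] at hr2
  have hrL : r + 1 ≤ L.card := by
    have : (r : ℝ) < L.card := by nlinarith [(Nat.cast_nonneg r : (0 : ℝ) ≤ r)]
    exact_mod_cast this
  obtain ⟨T, hTL, hT⟩ := Finset.exists_subset_card_eq hrL
  let B : ι → Finset α := fun i => A i \ (T.erase i).biUnion A
  have hB : ∀ i ∈ T, M / 2 ≤ (B i).card := by
    intro i hi
    have hle : (A i).card ≤ (B i).card + ∑ j ∈ T.erase i, (A i ∩ A j).card := by
      calc (A i).card = (B i).card + (A i ∩ (T.erase i).biUnion A).card :=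
            (Finset.card_sdiff_add_card_inter _ _).symm
        _ ≤ _ := by
          rw [Finset.inter_biUnion]
          gcongr
          exact Finset.card_biUnion_le
    have hsum : ((∑ j ∈ T.erase i, (A i ∩ A j).card : ℕ) : ℝ) ≤ r * D := by
      push_cast
      have := Finset.sum_le_card_nsmul (T.erase i) (fun j => ((A i ∩ A j).card : ℝ)) D
        (fun j hj => hD i (hTL hi) j (hTL (Finset.mem_of_mem_erase hj))
          (Finset.ne_of_mem_erase hj).symm)
      rwa [Finset.card_erase_of_mem hi, hT, Nat.add_sub_cancel, nsmul_eq_mul] at this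
    have hrD : r * D ≤ M / 2 := by
      rcases le_total D 0 with h | h
      · nlinarith [(Nat.cast_nonneg r : (0 : ℝ) ≤ r)]
      · have : C * (2 * (r * D)) ≤ C * M := by nlinarith
        have := le_of_mul_le_mul_left this (by positivity)
        linarith
    have hle' : ((A i).card : ℝ) ≤
        (B i).card + ((∑ j ∈ T.erase i, (A i ∩ A j).card : ℕ) : ℝ) := by exact_mod_cast hle
    linarith [hA i (hTL hi)]
  have hdisj : (T : Set ι).PairwiseDisjoint B := by
    intro i hi j hj hij
    refine Finset.disjoint_left.2 fun a hai haj => ?_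
    simp only [B, Finset.mem_sdiff, Finset.mem_biUnion, not_exists, not_and] at hai haj
    exact hai.2 j (Finset.mem_erase.2 ⟨hij.symm, hj⟩) haj.1
  have hsub : T.biUnion B ⊆ P :=
    Finset.biUnion_subset.2 fun i hi => Finset.sdiff_subset.trans (hAP i (hTL hi))
  have hcard := Finset.card_le_card hsub
  rw [Finset.card_biUnion hdisj] at hcard
  have hcard' : (∑ i ∈ T, ((B i).card : ℝ)) ≤ P.card := by exact_mod_cast hcard
  have hlow := Finset.card_nsmul_le_sum T (fun i => ((B i).card : ℝ)) (M / 2) hB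
  rw [hT, nsmul_eq_mul] at hlow
  push_cast at hlow
  nlinarith

theorem pow_mul_pow_le_two_pow_mul_prod {q : ℕ} (hq : 2 ≤ q) (d : ℕ) :
    (q ^ d) ^ d ≤ 2 ^ d * ∏ i : Fin d, (q ^ d - q ^ (i : ℕ)) := by
  have h : ∀ i : Fin d, q ^ d ≤ 2 * (q ^ d - q ^ (i : ℕ)) := by
    intro i
    have h1 : q ^ (i : ℕ) * 2 ≤ q ^ d :=
      calc q ^ (i : ℕ) * 2 ≤ q ^ (i : ℕ) * q := by gcongr
        _ = q ^ ((i : ℕ) + 1) := (pow_succ _ _).symm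
        _ ≤ q ^ d := Nat.pow_le_pow_right (by omega) i.2
    omega
  simpa [Finset.prod_mul_distrib] using Finset.prod_le_prod' (s := Finset.univ) fun i _ => h i

section Planes

variable {F V : Type*} [Field F] [AddCommGroup V] [Module F V]

theorem mem_vadd_submodule {a x : V} {W : Submodule F V} :
    a ∈ x +ᵥ (W : Set V) ↔ -x + a ∈ W := by
  rw [Set.mem_vadd_set_iff_neg_vadd_mem]; rfl

theorem vadd_submodule_eq_of_mem {x y : V} {W : Submodule F V} (h : y ∈ x +ᵥ (W : Set V)) :
    x +ᵥ (W : Set V) = y +ᵥ (W : Set V) := by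
  ext a
  rw [mem_vadd_submodule] at h
  rw [mem_vadd_submodule, mem_vadd_submodule, ← W.add_mem_iff_right (x := -x + y) (y := -y + a) h]
  simp [add_assoc]

variable [Fintype F] [Finite V]

/-- Double counting of pairs (point, basis of the direction) bounds the number of `d`-planes inside
a coset of `U`. -/
theorem ncard_planes_mul_le (U : Submodule F V) (y : V) (d : ℕ) (Q : Set (Set V))
    (hQ : ∀ p ∈ Q, IsPlane F d p) (hQU : ∀ p ∈ Q, p ⊆ y +ᵥ (U : Set V)) :
    Q.ncard * (Fintype.card F ^ d * ∏ i : Fin d, (Fintype.card F ^ d - Fintype.card F ^ (i : ℕ)))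
      ≤ Fintype.card F ^ (Module.finrank F U * (d + 1)) := by
  choose x W hW hp using fun p : Q => hQ p p.2
  have hx : ∀ p (w : W p), -y + (x p + w) ∈ U := by
    intro p w
    refine mem_vadd_submodule.1 (hQU p p.2 ?_)
    rw [hp p, mem_vadd_submodule]
    simp
  have hWU : ∀ p (w : W p), (w : V) ∈ U := by
    intro p w
    have := U.sub_mem (hx p w) (hx p 0)
    simpa using this
  let g : (Σ p : Q, W p × {s : Fin d → W p // LinearIndependent F s}) → U × (Fin d → U) :=
    fun t => (⟨-y + (x t.1 + t.2.1), hx _ _⟩, fun i => ⟨t.2.2.1 i, hWU _ _⟩)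
  have hspan : ∀ p (s : Fin d → W p), LinearIndependent F s →
      Submodule.span F (Set.range fun i => (s i : V)) = W p := by
    intro p s hs
    have h1 := hs.span_eq_top_of_card_eq_finrank' (by simp [hW p])
    have h2 := congrArg (Submodule.map (W p).subtype) h1
    rw [Submodule.map_span, ← Set.range_comp, Submodule.map_top, Submodule.range_subtype] at h2
    exact h2
  have hg : Function.Injective g := by
    rintro ⟨p, w, s, hs⟩ ⟨p', w', s', hs'⟩ h
    simp only [g, Prod.mk.injEq, Subtype.mk.injEq, funext_iff, add_right_inj] at h
    obtain ⟨h1, h2⟩ := h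
    have hWW : W p = W p' := by
      rw [← hspan p s hs, ← hspan p' s' hs', funext h2]
    have hpp : p = p' := by
      apply Subtype.ext
      have e1 := vadd_submodule_eq_of_mem (x := x p) (y := x p + w) (W := W p)
        (by simp [mem_vadd_submodule])
      have e2 := vadd_submodule_eq_of_mem (x := x p') (y := x p' + w') (W := W p')
        (by simp [mem_vadd_submodule])
      rw [hp p, hp p', e1, e2, h1, hWW]
    subst hpp
    obtain rfl : w = w' := Subtype.ext (add_left_cancel h1)
    obtain rfl : s = s' := funext fun i => Subtype.ext (h2 i)
    rfl
  have hcard := Nat.card_le_card_of_injective g hg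
  have := Fintype.ofFinite Q
  rw [Nat.card_sigma, Nat.card_prod, Nat.card_fun, Module.natCard_eq_pow_finrank (K := F) (V := U),
    Nat.card_eq_fintype_card, Nat.card_eq_fintype_card, Fintype.card_fin] at hcard
  have hfib : ∀ p : Q, Nat.card (W p × {s : Fin d → W p // LinearIndependent F s}) =
      Fintype.card F ^ d * ∏ i : Fin d, (Fintype.card F ^ d - Fintype.card F ^ (i : ℕ)) := by
    intro p
    rw [Nat.card_prod, card_linearIndependent (by rw [hW p]),
      Module.natCard_eq_pow_finrank (K := F), hW p, Nat.card_eq_fintype_card]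
  simp only [hfib, Finset.sum_const, Finset.card_univ, smul_eq_mul] at hcard
  rw [← Nat.card_coe_set_eq, Nat.card_eq_fintype_card]
  refine hcard.trans_eq ?_
  rw [pow_mul, pow_succ']

theorem ncard_planes_subset_inter_le {m k : ℕ} (hk : 0 < k) (hkm : k ≤ m) {ℓ ℓ' : Set V}
    (hℓ : IsPlane F m ℓ) (hℓ' : IsPlane F m ℓ') (hne : ℓ ≠ ℓ') (Q : Set (Set V))
    (hQ : ∀ p ∈ Q, IsPlane F (k - 1) p) (hQℓ : ∀ p ∈ Q, p ⊆ ℓ) (hQℓ' : ∀ p ∈ Q, p ⊆ ℓ') :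
    Q.ncard ≤ 2 ^ (k - 1) * Fintype.card F ^ (k * (m - k)) := by
  rcases Q.eq_empty_or_nonempty with rfl | ⟨p, hpQ⟩
  · simp
  obtain ⟨y, hy⟩ : p.Nonempty := by
    obtain ⟨x, W, -, rfl⟩ := hQ p hpQ
    exact ⟨x, by simp [mem_vadd_submodule]⟩
  obtain ⟨x, W, hW, rfl⟩ := hℓ
  obtain ⟨x', W', hW', rfl⟩ := hℓ'
  rw [vadd_submodule_eq_of_mem (hQℓ p hpQ hy)] at hne hQℓ
  rw [vadd_submodule_eq_of_mem (hQℓ' p hpQ hy)] at hne hQℓ'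
  have hlt : W ⊓ W' < W := by
    refine lt_of_le_of_ne inf_le_left fun h => hne ?_
    rw [Submodule.eq_of_le_of_finrank_eq (inf_eq_left.1 h) (hW.trans hW'.symm)]
  have hdim := Submodule.finrank_lt_finrank_of_lt hlt
  rw [hW] at hdim
  have hcount := ncard_planes_mul_le (W ⊓ W') y (k - 1) Q hQ fun p hp a ha =>
    mem_vadd_submodule.2 ⟨mem_vadd_submodule.1 (hQℓ p hp ha), mem_vadd_submodule.1 (hQℓ' p hp ha)⟩
  have hq : 2 ≤ Fintype.card F := Fintype.one_lt_card
  have hprod := pow_mul_pow_le_two_pow_mul_prod hq (k - 1)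
  obtain ⟨d, rfl⟩ : ∃ d, k = d + 1 := ⟨k - 1, by omega⟩
  obtain ⟨e, rfl⟩ : ∃ e, m = d + 1 + e := ⟨m - (d + 1), by omega⟩
  simp only [Nat.add_sub_cancel, Nat.add_sub_cancel_left] at *
  set q := Fintype.card F
  refine Nat.le_of_mul_le_mul_right (c := q ^ d * (q ^ d) ^ d) ?_ (by positivity)
  calc Q.ncard * (q ^ d * (q ^ d) ^ d)
      ≤ Q.ncard * (q ^ d * (2 ^ d * ∏ i : Fin d, (q ^ d - q ^ (i : ℕ)))) := by
        gcongr _ * (_ * ?_)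
        exact hprod
    _ = 2 ^ d * (Q.ncard * (q ^ d * ∏ i : Fin d, (q ^ d - q ^ (i : ℕ)))) := by ring
    _ ≤ 2 ^ d * q ^ (Module.finrank F ↥(W ⊓ W') * (d + 1)) := Nat.mul_le_mul_left _ hcount
    _ ≤ 2 ^ d * q ^ ((d + e) * (d + 1)) := by
        gcongr
        · omega
        · omega
    _ = 2 ^ d * q ^ ((d + 1) * e) * (q ^ d * (q ^ d) ^ d) := by ring

end Planes

/-- **Lemma 2.3 (classical method).** -/
theorem classical_counting_lemma (k m : ℕ) (hk : 0 < k) (hkm : k ≤ m) :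
    ∃ c : ℝ, 0 < c ∧
      ∀ (F : Type) [Field F] [Fintype F] (n : ℕ)
        (L P : Set (Set (Fin n → F))) (M : ℝ), 0 < M →
        (∀ ℓ ∈ L, IsPlane F m ℓ) →
        (∀ p ∈ P, IsPlane F (k - 1) p) →
        (∀ ℓ ∈ L, M ≤ ({p ∈ P | p ⊆ ℓ}.ncard : ℝ)) →
        (L.ncard : ℝ) * (Fintype.card F : ℝ) ^ (k * (m - k)) ≤ M →
        (P.ncard : ℝ) ≥ c * (L.ncard : ℝ) * M := by
  classical
  have hC : (1 : ℝ) ≤ 2 ^ (k - 1) := one_le_pow₀ (by norm_num)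
  refine ⟨(4 * 2 ^ (k - 1))⁻¹, by positivity, ?_⟩
  intro F _ _ n L P M hM hL hP hLP hLM
  have hLf := L.toFinite
  have hPf := P.toFinite
  have hset : ∀ ℓ : Set (Fin n → F),
      (({p ∈ P | p ⊆ ℓ}.toFinite.toFinset : Finset _) : Set _) = {p ∈ P | p ⊆ ℓ} :=
    fun ℓ => Set.Finite.coe_toFinset _
  have key := card_mul_le_of_card_inter_le hLf.toFinset
    (fun ℓ => {p ∈ P | p ⊆ ℓ}.toFinite.toFinset) hPf.toFinset
    (D := 2 ^ (k - 1) * (Fintype.card F : ℝ) ^ (k * (m - k))) hM hC ?_ ?_ ?_ ?_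
  · rw [← Set.ncard_eq_toFinset_card, ← Set.ncard_eq_toFinset_card] at key
    rw [ge_iff_le, mul_assoc, inv_mul_le_iff₀ (by positivity)]
    exact key
  · intro ℓ _ p hp
    simp only [Set.Finite.mem_toFinset, Set.mem_ofPred_eq] at hp ⊢
    exact hp.1
  · intro ℓ hℓ
    rw [← Set.ncard_eq_toFinset_card]
    exact hLP ℓ (hLf.mem_toFinset.1 hℓ)
  · intro ℓ hℓ ℓ' hℓ' hne
    rw [← Set.ncard_coe_finset, Finset.coe_inter, hset, hset]
    have hle := ncard_planes_subset_inter_le hk hkm (hL ℓ (hLf.mem_toFinset.1 hℓ))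
      (hL ℓ' (hLf.mem_toFinset.1 hℓ')) hne ({p ∈ P | p ⊆ ℓ} ∩ {p ∈ P | p ⊆ ℓ'})
      (fun p hp => hP p hp.1.1) (fun p hp => hp.1.2) (fun p hp => hp.2.2)
    exact_mod_cast hle
  · rw [← Set.ncard_eq_toFinset_card, mul_left_comm]
    gcongr
end

section
/- Let d ≥ 1 be an integer and let 0 < γ ≤ 1, 0 < λ ≤ 1 be real numbers. There exists a constant c > 0 depending only on d, γ, λ such that: for every finite field F, every n, every real β with max(1-d, -1) ≤ β ≤ 1, every collection L of lines in F^n with |L| ≥ γ · |F|^{2(d-1)+β}, and every collection P of points in F^n satisfying |{x ∈ P : x ∈ ℓ}| ≥ λ · |F| for every line ℓ ∈ L, one has |P| ≥ c · |F|^{d + max(0,β)}. -/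
open scoped Pointwise

namespace MvPolynomial

theorem totalDegree_pderiv_lt {σ R : Type*} [CommSemiring R] {i : σ} {f : MvPolynomial σ R}
    (h : pderiv i f ≠ 0) : (pderiv i f).totalDegree < f.totalDegree := by
  classical
  obtain ⟨m, hm, hdeg⟩ := Finset.exists_mem_eq_sup _ (support_nonempty.2 h)
    (fun s : σ →₀ ℕ => s.sum fun _ e => e)
  have hmem : m + Finsupp.single i 1 ∈ f.support := by
    rw [mem_support_iff, coeff_pderiv] at hm
    exact mem_support_iff.2 (left_ne_zero_of_mul hm)
  have hle := le_totalDegree hmem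
  rw [Finsupp.sum_add_index' (by simp) (by simp), Finsupp.sum_single_index rfl] at hle
  rw [totalDegree, hdeg]
  exact hle

theorem totalDegree_pow_of_ne_zero {σ R : Type*} [CommRing R] [IsDomain R] {f : MvPolynomial σ R}
    (hf : f ≠ 0) (n : ℕ) : (f ^ n).totalDegree = n * f.totalDegree := by
  induction n with
  | zero => simp
  | succ n ih => rw [pow_succ, totalDegree_mul_of_isDomain (pow_ne_zero n hf) hf, ih, Nat.succ_mul]

/-- Over a perfect field of characteristic `p`, a polynomial with vanishing derivatives is a `p`-th
power. -/
theorem exists_pow_eq_of_pderiv_eq_zero {σ K : Type*} [Field K] (p : ℕ) [Fact p.Prime]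
    [CharP K p] [PerfectRing K p] {f : MvPolynomial σ K} (hf : ∀ i, pderiv i f = 0) :
    ∃ g : MvPolynomial σ K, g ^ p = f := by
  classical
  have hdvd : ∀ m ∈ f.support, ∀ i, p ∣ m i := by
    intro m hm i
    by_contra hnd
    have hpos : 1 ≤ m i := Nat.one_le_iff_ne_zero.2 fun h0 => hnd (h0 ▸ dvd_zero p)
    have hsplit : m - Finsupp.single i 1 + Finsupp.single i 1 = m :=
      tsub_add_cancel_of_le (Finsupp.single_le_iff.2 hpos)
    have hc := coeff_pderiv (i := i) f (m - Finsupp.single i 1)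
    rw [hf i, hsplit, coeff_zero] at hc
    have hcast : ((m - Finsupp.single i 1 : σ →₀ ℕ) i + 1 : K) = (m i : K) := by
      conv_rhs => rw [← hsplit]
      simp
    rw [hcast] at hc
    exact mul_ne_zero (mem_support_iff.1 hm)
      (fun h0 => hnd ((CharP.cast_eq_zero_iff K p _).1 h0)) hc.symm
  refine ⟨∑ e ∈ f.support, monomial (e.mapRange (· / p) (Nat.zero_div p))
    ((frobeniusEquiv K p).symm (coeff e f)), ?_⟩
  rw [sum_pow_char]
  conv_rhs => rw [f.as_sum]
  refine Finset.sum_congr rfl fun e he => ?_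
  rw [monomial_pow, frobeniusEquiv_symm_pow_p]
  congr 2
  ext i
  simpa using Nat.mul_div_cancel' (hdvd e he i)

theorem derivative_aeval {σ R : Type*} [Fintype σ] [CommSemiring R] (w : σ → Polynomial R)
    (f : MvPolynomial σ R) :
    Polynomial.derivative (aeval w f)
      = ∑ i, Polynomial.derivative (w i) * aeval w (pderiv i f) := by
  classical
  induction f using MvPolynomial.induction_on with
  | C a => simp
  | add p q hp hq => simp [hp, hq, mul_add, Finset.sum_add_distrib]
  | mul_X p j hp =>
    simp only [map_mul, aeval_X, Polynomial.derivative_mul, hp, pderiv_mul, map_add, mul_add,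
      Finset.sum_add_distrib, pderiv_X]
    congr 1
    · rw [Finset.sum_mul]
      exact Finset.sum_congr rfl fun i _ => by ring
    · rw [Finset.sum_eq_single j]
      · simp [mul_comm]
      · intro i _ hij
        simp [hij.symm]
      · simp

theorem eval_aeval_polynomial {σ R : Type*} [CommSemiring R] (w : σ → Polynomial R)
    (f : MvPolynomial σ R) (t : R) :
    Polynomial.eval t (aeval w f) = eval (fun i => Polynomial.eval t (w i)) f := by
  induction f using MvPolynomial.induction_on with
  | C a => simp
  | add p q hp hq => simp [hp, hq]
  | mul_X p j hp => simp [hp]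

/-- A polynomial with more zeros on a line than its degree has zero derivative along the line. -/
theorem sum_mul_pderiv_eq_zero_of_card_lt {σ K : Type*} [Fintype σ] [Field K] (x v : σ → K)
    (f : MvPolynomial σ K) (T : Finset K) (hT : ∀ t ∈ T, eval (x + t • v) f = 0)
    (hcard : f.totalDegree < T.card) : ∑ i, v i * eval x (pderiv i f) = 0 := by
  let w : σ → Polynomial K := fun i => Polynomial.C (x i) + Polynomial.X * Polynomial.C (v i)
  have hw : ∀ t, (fun i => Polynomial.eval t (w i)) = x + t • v := by
    intro t
    funext i
    simp [w, mul_comm (v i) t]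
  have hdeg : (aeval w f).natDegree ≤ f.totalDegree * 1 :=
    aeval_natDegree_le f le_rfl w fun i => by
      simp only [w]
      compute_degree
  have hzero : aeval w f = 0 := Polynomial.eq_zero_of_natDegree_lt_card_of_eval_eq_zero' _ T
    (fun t ht => by rw [eval_aeval_polynomial, hw, hT t ht]) (by omega)
  have hder := derivative_aeval w f
  rw [hzero, Polynomial.derivative_zero] at hder
  have hsum := congrArg (Polynomial.eval 0) hder
  simp only [Polynomial.eval_zero, Polynomial.eval_finsetSum, Polynomial.eval_mul,
    eval_aeval_polynomial, hw] at hsum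
  simpa [w] using hsum.symm

/-- Fewer than `s ^ k` points lie in the zero set of a nonzero polynomial in `k` variables whose
degree in each variable is less than `s`. -/
theorem exists_ne_zero_eval_eq_zero_of_card_lt {K : Type*} [Field K] {k s : ℕ}
    (Q : Finset (Fin k → K)) (hQ : Q.card < s ^ k) :
    ∃ f : MvPolynomial (Fin k) K, f ≠ 0 ∧ f.totalDegree ≤ k * (s - 1) ∧ ∀ x ∈ Q, eval x f = 0 := by
  classical
  let S : Set (Fin k →₀ ℕ) := Set.range fun e : Fin k → Fin s =>
    Finsupp.equivFunOnFinite.symm fun i => (e i : ℕ)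
  have hinj : Function.Injective fun e : Fin k → Fin s =>
      Finsupp.equivFunOnFinite.symm fun i => (e i : ℕ) := by
    intro a b hab
    funext i
    exact Fin.ext (congrFun (Finsupp.equivFunOnFinite.symm.injective hab) i)
  have hrank : Module.finrank K (restrictSupport K S) = s ^ k := by
    rw [Module.finrank_eq_nat_card_basis (basisRestrictSupport K S),
      Nat.card_congr (Equiv.ofInjective _ hinj).symm]
    simp
  have : Module.Finite K (restrictSupport K S) :=
    Module.Finite.of_basis (basisRestrictSupport K S)
  let ev : restrictSupport K S →ₗ[K] (Q → K) :=
    (LinearMap.pi fun x : Q => (aeval (R := K) (x : Fin k → K)).toLinearMap).comp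
      (restrictSupport K S).subtype
  have hker : LinearMap.ker ev ≠ ⊥ := LinearMap.ker_ne_bot_of_finrank_lt (by simpa [hrank] using hQ)
  obtain ⟨f, hf, hf0⟩ := Submodule.exists_mem_ne_zero_of_ne_bot hker
  refine ⟨f, fun h => hf0 (Subtype.ext h), ?_, fun x hx => ?_⟩
  · refine Finset.sup_le fun m hm => ?_
    obtain ⟨e, rfl⟩ := (mem_restrictSupport_iff K).1 f.2 hm
    rw [Finsupp.sum_fintype _ _ (by simp)]
    refine (Finset.sum_le_card_nsmul _ _ (s - 1) fun i _ => ?_).trans (by simp)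
    exact Nat.le_sub_one_of_lt (e i).2
  · have := congrFun (LinearMap.mem_ker.1 hf) ⟨x, hx⟩
    simpa [ev, aeval_eq_eval] using this

end MvPolynomial

/-- Linear maps into `K ^ k`, given by iterated Frobenius maps, that are generic over `F`. -/
theorem exists_linearMap_finrank_ker_lt (F : Type) [Field F] [Fintype F] (n k : ℕ) :
    ∃ π : (Fin n → F) →ₗ[F] (Fin k → AlgebraicClosure F),
      ∀ c : Fin k → AlgebraicClosure F, c ≠ 0 → ∃ W : Submodule F (Fin n → F),
        Module.finrank F W < k ∧ ∀ v, ∑ i, π v i * c i = 0 → v ∈ W := by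
  classical
  set K := AlgebraicClosure F
  have hrank : (n : Cardinal) ≤ Module.rank F K := by
    refine le_trans (Cardinal.natCast_lt_aleph0 (n := n)).le ?_
    by_contra hlt
    have : Module.Finite F K := Module.rank_lt_aleph0_iff.1 (not_le.1 hlt)
    have : Finite K := Module.finite_of_finite F
    exact not_finite K
  obtain ⟨b, hb⟩ := exists_linearIndependent_of_le_rank hrank
  let α : (Fin n → F) →ₗ[F] K := Fintype.linearCombination F b
  have hα : Function.Injective α := LinearIndependent.fintypeLinearCombination_injective hb
  let π : (Fin n → F) →ₗ[F] (Fin k → K) := LinearMap.pi fun i =>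
    ((FiniteField.frobeniusAlgHom F K) ^ (i : ℕ)).toLinearMap.comp α
  have hπ : ∀ v i, π v i = α v ^ (Fintype.card F ^ (i : ℕ)) := by
    intro v i
    simp only [π, LinearMap.pi_apply, LinearMap.comp_apply, AlgHom.toLinearMap_apply,
      AlgHom.coe_pow, FiniteField.coe_frobeniusAlgHom, pow_iterate]
  refine ⟨π, fun c hc => ?_⟩
  let φ : (Fin k → K) →ₗ[F] K := ∑ i, (LinearMap.mulRight F (c i)).comp (LinearMap.proj i)
  have hφ : ∀ u, φ u = ∑ i, u i * c i := by
    intro u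
    simp [φ]
  refine ⟨LinearMap.ker (φ.comp π), ?_, fun v hv => by simp [hφ, hv]⟩
  set q := Fintype.card F
  have hq : 1 < q := Fintype.one_lt_card
  let g : Polynomial K := ∑ i, Polynomial.C (c i) * Polynomial.X ^ (q ^ (i : ℕ))
  obtain ⟨i₀, hi₀⟩ := Function.ne_iff.1 hc
  have hg : g ≠ 0 := by
    intro h0
    have hcoeff : g.coeff (q ^ (i₀ : ℕ)) = c i₀ := by
      simp only [g, Polynomial.finsetSum_coeff, Polynomial.coeff_C_mul_X_pow,
        (Nat.pow_right_injective hq).eq_iff, Fin.val_inj]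
      simp
    exact hi₀ (by rw [← hcoeff, h0]; simp)
  have hdeg : g.natDegree ≤ q ^ (k - 1) :=
    Polynomial.natDegree_sum_le_of_forall_le _ _ fun i _ =>
      (Polynomial.natDegree_C_mul_X_pow_le _ _).trans
        (Nat.pow_le_pow_right hq.le (Nat.le_sub_one_of_lt i.2))
  have hcard : Fintype.card (LinearMap.ker (φ.comp π)) ≤ g.natDegree := by
    refine le_trans ?_ (Polynomial.card_roots' g)
    refine le_trans ?_ (Multiset.toFinset_card_le _)
    rw [← Finset.card_univ]
    refine Finset.card_le_card_of_injOn (fun v => α v) (fun v _ => ?_)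
      (fun v _ w _ h => Subtype.ext (hα h))
    have hv : ∑ i, π v i * c i = 0 := by
      rw [← hφ]
      exact v.2
    have hroot : g.eval (α v) = 0 := by
      rw [← hv, Polynomial.eval_finsetSum]
      exact Finset.sum_congr rfl fun i _ => by
        rw [hπ, Polynomial.eval_C_mul, Polynomial.eval_pow, Polynomial.eval_X, mul_comm]
    simpa [hg] using hroot
  rw [Module.card_eq_pow_finrank (K := F)] at hcard
  have := (Nat.pow_le_pow_iff_right hq).1 (hcard.trans hdeg)
  have := i₀.2
  omega

/-- A direction vector of a line. -/
theorem IsPlane.exists_direction {F : Type*} [Field F] {V : Type*} [AddCommGroup V] [Module F V]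
    {ℓ : Set V} (h : IsPlane F 1 ℓ) : ∃ v : V, v ≠ 0 ∧
      ∀ x ∈ ℓ, ∀ y, y ∈ ℓ ↔ ∃ t : F, y = x + t • v := by
  obtain ⟨a, W, hW, rfl⟩ := h
  obtain ⟨⟨v, hvW⟩, hv0, hv⟩ := finrank_eq_one_iff'.1 hW
  refine ⟨v, fun h0 => hv0 (Subtype.ext h0), fun x hx y => ?_⟩
  have hmem : ∀ z, z ∈ a +ᵥ (W : Set V) ↔ z - a ∈ W := by
    intro z
    rw [Set.mem_vadd_set_iff_neg_vadd_mem, vadd_eq_add, neg_add_eq_sub, SetLike.mem_coe]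
  rw [hmem] at hx ⊢
  constructor
  · intro hy
    obtain ⟨t, ht⟩ := hv ⟨y - x, by simpa using W.sub_mem hy hx⟩
    refine ⟨t, ?_⟩
    have : t • v = y - x := congrArg Subtype.val ht
    rw [this, add_sub_cancel]
  · rintro ⟨t, rfl⟩
    rw [add_sub_right_comm]
    exact W.add_mem hx (W.smul_mem t hvW)

/-- A joints bound: if every line has at least `m` points of `P`, and at each point of `P` the lines
through it do not lie in a common plane of dimension less than `k`, then `P` is large. -/
theorem pow_le_card_of_joints (F : Type) [Field F] [Fintype F] {n k s m : ℕ}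
    (hm : k * (s - 1) < m) (L : Finset (Set (Fin n → F))) (P : Finset (Fin n → F))
    (hP : P.Nonempty) (hL : ∀ ℓ ∈ L, IsPlane F 1 ℓ)
    (hLP : ∀ ℓ ∈ L, ∃ S ⊆ P, (S : Set (Fin n → F)) ⊆ ℓ ∧ m ≤ S.card)
    (hspan : ∀ x ∈ P, ∀ W : Submodule F (Fin n → F), Module.finrank F W < k →
      ∃ ℓ ∈ L, x ∈ ℓ ∧ ∃ y ∈ ℓ, y - x ∉ W) :
    s ^ k ≤ P.card := by
  classical
  obtain ⟨p, hp⟩ := CharP.exists F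
  have hprime : Fact p.Prime := ⟨CharP.char_is_prime F p⟩
  obtain ⟨π, hπ⟩ := exists_linearMap_finrank_ker_lt F n k
  let K := AlgebraicClosure F
  by_contra! hlt
  let vanishing : Set (MvPolynomial (Fin k) K) :=
    {f | f ≠ 0 ∧ ∀ x ∈ P, MvPolynomial.eval (π x) f = 0}
  obtain ⟨f₀, hf₀, hdeg₀, hev₀⟩ := MvPolynomial.exists_ne_zero_eval_eq_zero_of_card_lt
    (P.image π) (Finset.card_image_le.trans_lt hlt)
  have hmem₀ : f₀ ∈ vanishing := ⟨hf₀, fun x hx => hev₀ _ (Finset.mem_image_of_mem π hx)⟩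
  obtain ⟨f, ⟨hf, hev⟩, hmin⟩ :=
    exists_minimalFor_of_wellFoundedLT (· ∈ vanishing) MvPolynomial.totalDegree ⟨f₀, hmem₀⟩
  have hmin' : ∀ g ∈ vanishing, f.totalDegree ≤ g.totalDegree := fun g hg =>
    (le_total _ _).elim id fun h => hmin hg h
  have hdeg : f.totalDegree < m := (hmin' f₀ hmem₀).trans_lt (hdeg₀.trans_lt hm)
  have hgrad : ∀ x ∈ P, ∀ i, MvPolynomial.eval (π x) (MvPolynomial.pderiv i f) = 0 := by
    intro x hx
    by_contra! hne
    obtain ⟨i₀, hi₀⟩ := hne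
    obtain ⟨W, hW, hker⟩ := hπ (fun i => MvPolynomial.eval (π x) (MvPolynomial.pderiv i f))
      (Function.ne_iff.2 ⟨i₀, hi₀⟩)
    obtain ⟨ℓ, hℓ, hxℓ, y, hy, hyW⟩ := hspan x hx W hW
    obtain ⟨v, hv0, hv⟩ := (hL ℓ hℓ).exists_direction
    obtain ⟨t, rfl⟩ := (hv x hxℓ y).1 hy
    refine hyW ?_
    rw [add_sub_cancel_left]
    refine W.smul_mem t (hker v ?_)
    obtain ⟨S, hSP, hSℓ, hS⟩ := hLP ℓ hℓ
    let T : Finset F := Finset.univ.filter fun t => x + t • v ∈ S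
    have hST : S.card ≤ T.card := by
      refine Finset.card_le_card_of_surjOn (fun t => x + t • v) fun z hz => ?_
      obtain ⟨t, rfl⟩ := (hv x hxℓ z).1 (hSℓ hz)
      exact ⟨t, by simpa [T] using hz, rfl⟩
    refine MvPolynomial.sum_mul_pderiv_eq_zero_of_card_lt (π x) (π v) f
      (T.map ⟨algebraMap F K, (algebraMap F K).injective⟩) ?_ ?_
    · intro t ht
      obtain ⟨t, htT, rfl⟩ := Finset.mem_map.1 ht
      have := hev _ (hSP (Finset.mem_filter.1 htT).2)
      rw [map_add, map_smul] at this
      exact (algebraMap_smul K t (π v)).symm ▸ this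
    · rw [Finset.card_map]
      omega
  have hpd : ∀ i, MvPolynomial.pderiv i f = 0 := by
    intro i
    by_contra hne
    exact (MvPolynomial.totalDegree_pderiv_lt hne).not_ge
      (hmin' _ ⟨hne, fun x hx => hgrad x hx i⟩)
  obtain ⟨g, rfl⟩ := MvPolynomial.exists_pow_eq_of_pderiv_eq_zero p hpd
  have hp0 : p ≠ 0 := hprime.out.ne_zero
  have hg0 : g ≠ 0 := fun h => hf (by rw [h, zero_pow hp0])
  have hgev : ∀ x ∈ P, MvPolynomial.eval (π x) g = 0 := fun x hx =>
    eq_zero_of_pow_eq_zero (by simpa using hev x hx)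
  have hle := hmin' g ⟨hg0, hgev⟩
  rw [MvPolynomial.totalDegree_pow_of_ne_zero hg0] at hle
  have hgdeg : g.totalDegree = 0 := by
    have := hprime.out.two_le
    nlinarith
  obtain ⟨x, hx⟩ := hP
  rw [MvPolynomial.totalDegree_eq_zero_iff_eq_C] at hgdeg
  have := hgev x hx
  rw [hgdeg, MvPolynomial.eval_C] at this
  exact hg0 (by rw [hgdeg, this, map_zero])

/-- Fewer than `2 q ^ (k - 2)` lines pass through a point inside a plane of dimension less
than `k`. -/
theorem card_lines_mul_card_lt (F : Type) [Field F] [Fintype F] {n k : ℕ}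
    (M : Finset (Set (Fin n → F))) (hM : ∀ ℓ ∈ M, IsPlane F 1 ℓ) (x : Fin n → F)
    (hx : ∀ ℓ ∈ M, x ∈ ℓ) (W : Submodule F (Fin n → F)) (hW : Module.finrank F W < k)
    (hMW : ∀ ℓ ∈ M, ∀ y ∈ ℓ, y - x ∈ W) :
    M.card * Fintype.card F < 2 * Fintype.card F ^ (k - 1) := by
  classical
  choose! v hv0 hv using fun ℓ hℓ => (hM ℓ hℓ).exists_direction
  have hvW : ∀ ℓ ∈ M, v ℓ ∈ W := fun ℓ hℓ => by
    simpa using hMW ℓ hℓ (x + (1 : F) • v ℓ) ((hv ℓ hℓ x (hx ℓ hℓ) _).2 ⟨1, rfl⟩)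
  have hsub : ∀ ℓ ∈ M, ∀ ℓ' ∈ M, ∀ u : F, v ℓ = u • v ℓ' → ℓ ⊆ ℓ' := by
    intro ℓ hℓ ℓ' hℓ' u hu z hz
    obtain ⟨s, rfl⟩ := (hv ℓ hℓ x (hx ℓ hℓ) z).1 hz
    exact (hv ℓ' hℓ' x (hx ℓ' hℓ') _).2 ⟨s * u, by rw [hu, smul_smul]⟩
  have hinj : Set.InjOn (fun a : Fˣ × Set (Fin n → F) => (a.1 : F) • v a.2)
      ((Finset.univ ×ˢ M : Finset (Fˣ × Set (Fin n → F))) : Set _) := by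
    rintro ⟨t, ℓ⟩ ha ⟨t', ℓ'⟩ hb hab
    have hℓ : ℓ ∈ M := by simpa using ha
    have hℓ' : ℓ' ∈ M := by simpa using hb
    have hab' : (t : F) • v ℓ = (t' : F) • v ℓ' := hab
    have heq : ℓ = ℓ' := by
      refine (hsub ℓ hℓ ℓ' hℓ' ((t⁻¹ : Fˣ) * t') ?_).antisymm
        (hsub ℓ' hℓ' ℓ hℓ ((t'⁻¹ : Fˣ) * t) ?_)
      · rw [mul_smul, ← hab', smul_smul, Units.inv_mul, one_smul]
      · rw [mul_smul, hab', smul_smul, Units.inv_mul, one_smul]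
    subst heq
    rw [Units.ext (smul_left_injective F (hv0 ℓ hℓ) hab')]
  have hmaps : Set.MapsTo (fun a : Fˣ × Set (Fin n → F) => (a.1 : F) • v a.2)
      ((Finset.univ ×ˢ M : Finset (Fˣ × Set (Fin n → F))) : Set _)
      (((Finset.univ.filter (· ∈ W)).erase 0 : Finset (Fin n → F)) : Set _) := by
    rintro ⟨t, ℓ⟩ ha
    have hℓ : ℓ ∈ M := by simpa using ha
    simpa [hv0 ℓ hℓ] using W.smul_mem (t : F) (hvW ℓ hℓ)
  have hcard := Finset.card_le_card_of_injOn _ hmaps hinj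
  have hWcard : (Finset.univ.filter (· ∈ W)).card = Fintype.card F ^ Module.finrank F W := by
    rw [← Module.card_eq_pow_finrank (K := F) (V := W), Fintype.card_subtype]
  rw [Finset.card_product, Finset.card_univ, Fintype.card_units,
    Finset.card_erase_of_mem (by simp), hWcard] at hcard
  have hq : 1 < Fintype.card F := Fintype.one_lt_card
  have hpow : Fintype.card F ^ Module.finrank F W ≤ Fintype.card F ^ (k - 1) :=
    Nat.pow_le_pow_right hq.le (by omega)
  have hpos : 0 < Fintype.card F ^ Module.finrank F W := by positivity
  have hle : M.card * Fintype.card F ≤ 2 * ((Fintype.card F - 1) * M.card) := by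
    calc M.card * Fintype.card F ≤ M.card * (2 * (Fintype.card F - 1)) :=
          Nat.mul_le_mul_left _ (by omega)
      _ = _ := by ring
  omega

/-- A set of incidences with large total weight contains a subset where every line is rich and every
point has many lines. -/
theorem exists_subset_rich_lines_and_points {V : Type*} [DecidableEq V]
    (L : Finset (Set V)) (P : Finset V) [∀ (ℓ : Set V) (x : V), Decidable (x ∈ ℓ)] (a b : ℝ)
    (ha : 0 < a) (hab : b * P.card < a * L.card)
    (hinc : ∀ ℓ ∈ L, 2 * a ≤ ((P.filter (· ∈ ℓ)).card : ℝ)) :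
    ∃ L' ⊆ L, ∃ P' ⊆ P, P'.Nonempty ∧ (∀ ℓ ∈ L', a ≤ ((P'.filter (· ∈ ℓ)).card : ℝ)) ∧
      ∀ x ∈ P', b ≤ ((L'.filter (x ∈ ·)).card : ℝ) := by
  classical
  let ι : Set V → V → ℝ := fun ℓ x => if x ∈ ℓ then 1 else 0
  have hrow : ∀ ℓ (Q : Finset V), ∑ x ∈ Q, ι ℓ x = ((Q.filter (· ∈ ℓ)).card : ℝ) := by
    intro ℓ Q
    simp [ι]
  have hcol : ∀ x (M : Finset (Set V)), ∑ ℓ ∈ M, ι ℓ x = ((M.filter (x ∈ ·)).card : ℝ) := by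
    intro x M
    simp [ι]
  let Φ : Finset (Set V) × Finset V → ℝ := fun X =>
    (∑ ℓ ∈ X.1, ∑ x ∈ X.2, ι ℓ x) - a * X.1.card - b * X.2.card
  obtain ⟨⟨L', P'⟩, hmem, hmax⟩ := Finset.exists_max_image (L.powerset ×ˢ P.powerset) Φ
    ⟨(L, P), by simp⟩
  obtain ⟨hL', hP'⟩ : L' ⊆ L ∧ P' ⊆ P := by simpa using hmem
  have hpos : 0 < Φ (L', P') := by
    refine lt_of_lt_of_le ?_ (hmax (L, P) (by simp))
    have hsum : L.card • (2 * a) ≤ ∑ ℓ ∈ L, ∑ x ∈ P, ι ℓ x :=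
      Finset.card_nsmul_le_sum _ _ _ fun ℓ hℓ => by
        rw [hrow]
        exact hinc ℓ hℓ
    rw [nsmul_eq_mul] at hsum
    simp only [Φ]
    linarith
  refine ⟨L', hL', P', hP', ?_, fun ℓ hℓ => ?_, fun x hx => ?_⟩
  · rw [Finset.nonempty_iff_ne_empty]
    rintro rfl
    have : 0 ≤ a * L'.card := by positivity
    simp only [Φ, Finset.sum_empty, Finset.sum_const_zero, Finset.card_empty, Nat.cast_zero] at hpos
    linarith
  · have h := hmax (L'.erase ℓ, P')
      (by simpa using ⟨(Finset.erase_subset _ _).trans hL', hP'⟩)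
    have hc : (L'.card : ℝ) = (L'.erase ℓ).card + 1 := by
      exact_mod_cast (Finset.card_erase_add_one hℓ).symm
    have hs := Finset.add_sum_erase L' (fun ℓ => ∑ x ∈ P', ι ℓ x) hℓ
    simp only [Φ, hc] at h
    rw [← hrow]
    linarith
  · have h := hmax (L', P'.erase x)
      (by simpa using ⟨hL', (Finset.erase_subset _ _).trans hP'⟩)
    have hc : (P'.card : ℝ) = (P'.erase x).card + 1 := by
      exact_mod_cast (Finset.card_erase_add_one hx).symm
    have hs := Finset.add_sum_erase P' (fun x => ∑ ℓ ∈ L', ι ℓ x) hx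
    simp only [Φ, hc] at h
    rw [Finset.sum_comm, Finset.sum_comm (s := L')] at h
    rw [← hcol]
    linarith

/-- Either `P` is large compared with `L`, or it has at least a positive proportion of the size of a
`k`-dimensional space. -/
theorem card_lines_le_or_pow_le_card (F : Type) [Field F] [Fintype F] {n k : ℕ} (hk : 1 ≤ k)
    (lam : ℝ) (hlam : 0 < lam) (L : Finset (Set (Fin n → F))) (P : Finset (Fin n → F))
    [∀ (ℓ : Set (Fin n → F)) (x : Fin n → F), Decidable (x ∈ ℓ)]
    (hL : ∀ ℓ ∈ L, IsPlane F 1 ℓ)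
    (hinc : ∀ ℓ ∈ L, lam * Fintype.card F ≤ ((P.filter (· ∈ ℓ)).card : ℝ)) :
    lam * (Fintype.card F : ℝ) ^ 2 * L.card ≤ 4 * (Fintype.card F : ℝ) ^ (k - 1) * P.card ∨
      (lam / (2 * k) * Fintype.card F) ^ k ≤ (P.card : ℝ) := by
  classical
  refine or_iff_not_imp_left.2 fun hlt => ?_
  rw [not_le] at hlt
  have hq : (0 : ℝ) < Fintype.card F := by exact_mod_cast Fintype.card_pos
  set q : ℝ := (Fintype.card F : ℝ) with hqdef
  have hk0 : (0 : ℝ) < k := by exact_mod_cast hk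
  have hab : 2 * q ^ (k - 1) / q * P.card < lam * q / 2 * L.card := by
    rw [div_mul_eq_mul_div, div_lt_iff₀ hq]
    linarith
  obtain ⟨L', hL', P', hP', hne, hrich, hmany⟩ := exists_subset_rich_lines_and_points L P
    (lam * q / 2) (2 * q ^ (k - 1) / q) (by positivity) hab
    (fun ℓ hℓ => by linarith [hinc ℓ hℓ])
  set m := ⌈lam * q / 2⌉₊ with hm
  have hm0 : 0 < m := Nat.ceil_pos.2 (by positivity)
  have hjoints : ((m - 1) / k + 1) ^ k ≤ P'.card := by
    refine pow_le_card_of_joints F (m := m) ?_ L' P' hne (fun ℓ hℓ => hL ℓ (hL' hℓ))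
      (fun ℓ hℓ => ⟨P'.filter (· ∈ ℓ), Finset.filter_subset _ _, fun y hy => ?_,
        Nat.ceil_le.2 (hrich ℓ hℓ)⟩) ?_
    · have := Nat.mul_div_le (m - 1) k
      rw [Nat.add_sub_cancel]
      omega
    · exact (Finset.mem_filter.1 hy).2
    · intro x hx W hW
      by_contra! hflat
      have hfew := card_lines_mul_card_lt F (L'.filter (x ∈ ·))
        (fun ℓ hℓ => hL ℓ (hL' (Finset.mem_filter.1 hℓ).1)) x
        (fun ℓ hℓ => (Finset.mem_filter.1 hℓ).2) W hW
        (fun ℓ hℓ => hflat ℓ (Finset.mem_filter.1 hℓ).1 (Finset.mem_filter.1 hℓ).2)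
      have hfew' : ((L'.filter (x ∈ ·)).card : ℝ) * q < 2 * q ^ (k - 1) := by
        rw [hqdef]
        exact_mod_cast hfew
      have := hmany x hx
      rw [div_le_iff₀ hq] at this
      linarith
  have hs : lam / (2 * k) * q ≤ (((m - 1) / k + 1 : ℕ) : ℝ) := by
    have hmk : m ≤ k * ((m - 1) / k + 1) := by
      have := Nat.lt_mul_div_succ (m - 1) hk
      omega
    have hmk' : (m : ℝ) ≤ k * (((m - 1) / k + 1 : ℕ) : ℝ) := by exact_mod_cast hmk
    have hle : lam * q / 2 ≤ m := Nat.le_ceil _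
    rw [show lam / (2 * k) * q = lam * q / 2 / k by field_simp, div_le_iff₀ hk0]
    linarith
  calc (lam / (2 * k) * q) ^ k ≤ (((m - 1) / k + 1 : ℕ) : ℝ) ^ k := by gcongr
    _ ≤ P'.card := by exact_mod_cast hjoints
    _ ≤ P.card := by exact_mod_cast Finset.card_le_card hP'

/-- **Proposition 3.1, estimate (3.1).** -/
theorem lines_points_incidence_bound (d : ℕ) (hd : 1 ≤ d)
    (γ lam : ℝ) (hγ0 : 0 < γ) (hγ1 : γ ≤ 1) (hlam0 : 0 < lam) (hlam1 : lam ≤ 1) :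
    ∃ c : ℝ, 0 < c ∧
      ∀ (F : Type) [Field F] [Fintype F] (n : ℕ) (β : ℝ),
        max (1 - (d : ℝ)) (-1) ≤ β → β ≤ 1 →
        ∀ (L : Set (Set (Fin n → F))) (P : Set (Fin n → F)),
          (∀ ℓ ∈ L, IsPlane F 1 ℓ) →
          (L.ncard : ℝ) ≥ γ * (Fintype.card F : ℝ) ^ (2 * ((d : ℝ) - 1) + β) →
          (∀ ℓ ∈ L, ({x ∈ P | x ∈ ℓ}.ncard : ℝ) ≥ lam * (Fintype.card F : ℝ)) →
          (P.ncard : ℝ) ≥ c * (Fintype.card F : ℝ) ^ ((d : ℝ) + max 0 β) := by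
  classical
  refine ⟨min (lam * γ / 4) (min ((lam / (2 * (d + 1 : ℕ))) ^ (d + 1)) ((lam / (2 * d)) ^ d)),
    by positivity, fun F _ _ n β hβ hβ1 L P hL hcard hinc => ?_⟩
  have hβ' : -1 ≤ β := (le_max_right _ _).trans hβ
  have hq1 : (1 : ℝ) ≤ Fintype.card F := by exact_mod_cast Fintype.card_pos
  have hinc' : ∀ ℓ ∈ L.toFinset, lam * Fintype.card F ≤ ((P.toFinset.filter (· ∈ ℓ)).card : ℝ) := by
    intro ℓ hℓ
    refine (hinc ℓ (Set.mem_toFinset.1 hℓ)).trans_eq ?_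
    rw [Set.ncard_eq_toFinset_card']
    congr 2
    ext y
    simp only [Finset.mem_filter, Set.mem_toFinset, Set.mem_ofPred_eq]
  have hdich := fun k hk => card_lines_le_or_pow_le_card F (k := k) hk lam hlam0 L.toFinset P.toFinset
    (fun ℓ hℓ => hL ℓ (Set.mem_toFinset.1 hℓ)) hinc'
  simp only [← Set.ncard_eq_toFinset_card'] at hdich
  set q : ℝ := (Fintype.card F : ℝ)
  have hq0 : 0 < q := by linarith
  -- The first alternative of the dichotomy, with the lower bound for the number of lines inserted.
  have hfirst : ∀ (k : ℕ) (e : ℝ), 1 ≤ k → e + k ≤ 2 * d + 1 + β →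
      lam * q ^ 2 * L.ncard ≤ 4 * q ^ (k - 1) * P.ncard → lam * γ / 4 * q ^ e ≤ P.ncard := by
    intro k e hk he h
    have hexp : q ^ e * q ^ (k - 1) ≤ q ^ 2 * q ^ (2 * ((d : ℝ) - 1) + β) := by
      rw [← Real.rpow_natCast q (k - 1), ← Real.rpow_natCast q 2, ← Real.rpow_add hq0,
        ← Real.rpow_add hq0]
      refine Real.rpow_le_rpow_of_exponent_le hq1 ?_
      push_cast [hk]
      linarith
    have hpow : 0 < q ^ (k - 1) := by positivity
    refine le_of_mul_le_mul_right ?_ hpow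
    have h1 : lam * q ^ 2 * (γ * q ^ (2 * ((d : ℝ) - 1) + β)) ≤ lam * q ^ 2 * L.ncard := by gcongr
    have h2 : lam * γ * (q ^ e * q ^ (k - 1))
        ≤ lam * γ * (q ^ 2 * q ^ (2 * ((d : ℝ) - 1) + β)) := by gcongr
    linarith
  rcases le_total 0 β with h0 | h0
  · rw [max_eq_right h0]
    rcases hdich (d + 1) (by omega) with h | h
    · refine (mul_le_mul_of_nonneg_right (min_le_left _ _) (by positivity)).trans
        (hfirst (d + 1) (d + β) (by omega) ?_ h)
      push_cast
      linarith
    · refine le_trans ?_ h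
      rw [mul_pow, ← Real.rpow_natCast q]
      refine mul_le_mul ((min_le_right _ _).trans (min_le_left _ _))
        (Real.rpow_le_rpow_of_exponent_le hq1 ?_) (by positivity) (by positivity)
      push_cast
      linarith
  · rw [max_eq_left h0, add_zero]
    rcases hdich d hd with h | h
    · exact (mul_le_mul_of_nonneg_right (min_le_left _ _) (by positivity)).trans
        (hfirst d d hd (by linarith) h)
    · refine le_trans ?_ h
      rw [mul_pow, ← Real.rpow_natCast q]
      exact mul_le_mul_of_nonneg_right ((min_le_right _ _).trans (min_le_right _ _))
        (by positivity)
end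

section
/- Let d ≥ 1 be an integer and set α = 2(d-1) + 1 (an arbitrary odd positive integer). There exists a constant c > 0 depending only on d such that for every finite field F, every n, and every collection L of lines in F^n with |L| ≥ |F|^α (with no structural assumption such as the Wolff axiom), one has |⋃_{ℓ ∈ L} ℓ| ≥ c · |F|^{(α+3)/2}. -/
open scoped Pointwise

section LineCounting

open Finset

open scoped Classical in
/-- The pairs `(a, u)` with `u ≠ 0` such that the line through `a` with direction `u` is
contained in `P`. -/
noncomputable def lineParams (F : Type*) [Field F] {V : Type*} [AddCommGroup V] [Module F V]
    [Fintype V] (P : Finset V) : Finset (V × V) :=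
  univ.filter fun p => p.2 ≠ 0 ∧ ∀ t : F, p.1 + t • p.2 ∈ P

variable {F : Type*} [Field F] {V : Type*} [AddCommGroup V] [Module F V] [Fintype V]

theorem mem_lineParams {P : Finset V} {p : V × V} :
    p ∈ lineParams F P ↔ p.2 ≠ 0 ∧ ∀ t : F, p.1 + t • p.2 ∈ P := by
  simp [lineParams]

variable {W : Type*} [AddCommGroup W] [Module F W] [Fintype W]

open scoped Classical in
/-- A nonzero vector is annihilated by a proportion `1 / |W|` of the linear maps into `W`. -/
theorem card_linearMap_apply_eq_zero [Fintype (V →ₗ[F] W)] {v : V} (hv : v ≠ 0) :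
    #{M : V →ₗ[F] W | M v = 0} * Fintype.card W = Fintype.card (V →ₗ[F] W) := by
  let e : (V →ₗ[F] W) →ₗ[F] W := LinearMap.applyₗ v
  have he : Function.Surjective e := by
    intro w
    obtain ⟨f, hf⟩ := Module.Projective.exists_dual_ne_zero F hv
    refine ⟨(f v)⁻¹ • f.smulRight w, ?_⟩
    simp [e, smul_smul, hf]
  have h := Submodule.card_eq_card_quotient_mul_card (LinearMap.ker e)
  rw [Nat.card_congr (e.quotKerEquivOfSurjective he).toEquiv] at h
  simp only [Nat.card_eq_fintype_card] at h
  rw [h, Fintype.card_subtype]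
  rfl

variable [Fintype F]

/-- A second-moment bound: a set `Q` of points contains few lines unless it has
positive density. -/
theorem card_mul_sq_le_of_line_subset (Q : Finset W) (G : Finset (W × W))
    (hG : ∀ p ∈ G, ∀ t : F, p.1 + t • p.2 ∈ Q) :
    (#G : ℝ) * Fintype.card F * (Fintype.card W - #Q) ^ 2 ≤ (Fintype.card W : ℝ) ^ 3 * #Q := by
  classical
  set q : ℝ := (Fintype.card F : ℝ) with hq
  set K : ℝ := (Fintype.card W : ℝ) with hK
  have hq0 : 0 < q := by rw [hq]; exact_mod_cast Fintype.card_pos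
  let χ : W → ℝ := fun x => if x ∈ Q then 1 else 0
  have hχ : ∑ x, χ x = #Q := by simp [χ]
  have hχχ : ∀ x, χ x * χ x = χ x := by intro x; simp [χ]
  let g : W × W → ℝ := fun p => ∑ t : F, χ (p.1 + t • p.2)
  have hshift : ∀ t : F, ∑ p : W × W, χ (p.1 + t • p.2) = K * #Q := by
    intro t
    rw [Fintype.sum_prod_type_right]
    have : ∀ u : W, ∑ a, χ (a + t • u) = #Q := fun u => by
      rw [← hχ]; exact Equiv.sum_comp (Equiv.addRight (t • u)) χ
    simp [this, hK]
  have h1 : ∑ p, g p = q * (K * #Q) := by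
    simp only [g]
    rw [sum_comm]
    simp [hshift, hq]
  have hpair : ∀ s t : F, s ≠ t →
      ∑ p : W × W, χ (p.1 + s • p.2) * χ (p.1 + t • p.2) = (#Q : ℝ) ^ 2 := by
    intro s t hst
    have hinj : Function.Injective (fun p : W × W => (p.1 + s • p.2, p.1 + t • p.2)) := by
      rintro ⟨a, u⟩ ⟨b, v⟩ h
      simp only [Prod.mk.injEq] at h
      obtain ⟨h₁, h₂⟩ := h
      have h₃ : (s - t) • (u - v) = 0 := by
        have : (s - t) • (u - v) = (a + s • u) - (b + s • v) - ((a + t • u) - (b + t • v)) := by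
          module
        rw [this, h₁, h₂]; simp
      have huv : u = v := sub_eq_zero.1 ((smul_eq_zero.1 h₃).resolve_left (sub_ne_zero.2 hst))
      subst huv
      simpa using h₁
    have hbij := Finite.injective_iff_bijective.1 hinj
    rw [hbij.sum_comp (fun p : W × W => χ p.1 * χ p.2), Fintype.sum_prod_type, sq, ← hχ,
      sum_mul_sum]
  have h2 : ∑ p, g p ^ 2 = q * (K * #Q) + q * (q - 1) * (#Q : ℝ) ^ 2 := by
    have : ∀ p, g p ^ 2 = ∑ s : F, ∑ t : F, χ (p.1 + s • p.2) * χ (p.1 + t • p.2) := by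
      intro p; simp only [g]; rw [sq, sum_mul_sum]
    simp only [this]
    rw [sum_comm]
    have hs : ∀ s : F, ∑ p : W × W, ∑ t : F, χ (p.1 + s • p.2) * χ (p.1 + t • p.2)
        = K * #Q + (q - 1) * (#Q : ℝ) ^ 2 := by
      intro s
      rw [sum_comm, ← add_sum_erase _ _ (mem_univ s)]
      congr 1
      · simp only [hχχ, hshift]
      · rw [sum_congr rfl fun t ht => hpair s t (ne_of_mem_erase ht).symm]
        rw [sum_const, nsmul_eq_mul, card_erase_of_mem (mem_univ s), card_univ,
          Nat.cast_sub Fintype.card_pos]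
        simp [hq]
    simp only [hs, sum_const, card_univ, nsmul_eq_mul]
    rw [← hq]; ring
  have hvar : ∑ p, (K * g p - q * #Q) ^ 2 = K ^ 2 * (q * (K * #Q) - q * (#Q : ℝ) ^ 2) := by
    have : ∀ p, (K * g p - q * #Q) ^ 2
        = K ^ 2 * g p ^ 2 - 2 * K * q * #Q * g p + (q * #Q) ^ 2 := fun p => by ring
    simp only [this, sum_add_distrib, sum_sub_distrib, ← mul_sum, h1, h2, sum_const, card_univ,
      Fintype.card_prod, nsmul_eq_mul, Nat.cast_mul]
    rw [← hK]; ring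
  have hlow : ∑ p ∈ G, (K * g p - q * #Q) ^ 2 = #G * (q * (K - #Q)) ^ 2 := by
    rw [sum_congr rfl (g := fun _ => (q * (K - #Q)) ^ 2), sum_const, nsmul_eq_mul]
    intro p hp
    have : g p = q := by simp [g, χ, hG p hp, hq]
    rw [this]; ring
  have hle : ∑ p ∈ G, (K * g p - q * #Q) ^ 2 ≤ ∑ p, (K * g p - q * #Q) ^ 2 :=
    sum_le_sum_of_subset_of_nonneg (subset_univ _) fun _ _ _ => sq_nonneg _
  rw [hlow, hvar] at hle
  refine le_of_mul_le_mul_left ?_ hq0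
  have : 0 ≤ K ^ 2 * (q * (#Q : ℝ) ^ 2) := by positivity
  nlinarith

open scoped Classical in
/-- For most linear maps `M`, the image of a given line in `P` under `M` is a line that is not
the image of any other parametrized line in `P`. -/
theorem card_collision_le [Fintype (V →ₗ[F] W)] (P : Finset V) {p : V × V}
    (hp : p.2 ≠ 0) :
    (Fintype.card F - 1) * Fintype.card W * #{M : V →ₗ[F] W | M p.2 ≠ 0 ∧
        ∃ p' ∈ lineParams F P, p' ≠ p ∧ Prod.map M M p' = Prod.map M M p}
      ≤ #P * Fintype.card F * Fintype.card (V →ₗ[F] W) := by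
  obtain ⟨a, u⟩ := p
  simp only [Prod.map_apply] at hp ⊢
  set B : Finset (V →ₗ[F] W) := {M : V →ₗ[F] W | M u ≠ 0 ∧
        ∃ p' ∈ lineParams F P, p' ≠ (a, u) ∧ Prod.map M M p' = (M a, M u)} with hB
  let P₀ : Finset V := {x ∈ P | ∀ t : F, x ≠ a + t • u}
  let R : (V →ₗ[F] W) → V → Prop := fun M x => ∃ t : F, M (x - (a + t • u)) = 0
  have hrow : ∀ M ∈ B, Fintype.card F - 1 ≤ #(bipartiteAbove R P₀ M) := by
    intro M hM
    obtain ⟨hMu, ⟨b, v⟩, hbv, hne, heq⟩ := (mem_filter.1 hM).2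
    simp only [Prod.map_apply, Prod.mk.injEq] at heq
    obtain ⟨hv, hbP⟩ := mem_lineParams.1 hbv
    have hfib : ∀ s t : F, b + s • v = a + t • u → s = t := by
      intro s t hst
      have := congrArg M hst
      simp only [map_add, map_smul, heq.1, heq.2, add_right_inj] at this
      exact smul_left_injective F hMu this
    let S : Finset F := {s : F | b + s • v ≠ a + s • u}
    have hS : Fintype.card F - 1 ≤ #S := by
      have hc : #({s : F | ¬ (b + s • v ≠ a + s • u)} : Finset F) ≤ 1 := by
        refine card_le_one.2 fun s hs t ht => ?_
        simp only [ne_eq, not_not, mem_filter, mem_univ, true_and] at hs ht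
        by_contra hst
        have h₃ : (s - t) • (v - u) = 0 := by
          have : (s - t) • (v - u) = (b + s • v) - (a + s • u) - ((b + t • v) - (a + t • u)) := by
            module
          rw [this, hs, ht]; simp
        have huv : v = u := sub_eq_zero.1 ((smul_eq_zero.1 h₃).resolve_left (sub_ne_zero.2 hst))
        subst huv
        exact hne (by simpa using hs)
      have := card_filter_add_card_filter_not (s := (univ : Finset F))
        (fun s : F => b + s • v ≠ a + s • u)
      rw [card_univ] at this
      simp only [S]
      omega
    refine hS.trans (card_le_card_of_injOn (fun s => b + s • v) ?_ ?_)
    · intro s hs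
      have hs' : b + s • v ≠ a + s • u := (mem_filter.1 hs).2
      simp only [bipartiteAbove, P₀, coe_filter, mem_filter, Set.mem_ofPred_eq]
      refine ⟨⟨hbP s, fun t ht => hs' ?_⟩, s, ?_⟩
      · rw [hfib s t ht]
        rw [hfib s t ht] at ht
        exact ht
      · simp [heq.1, heq.2]
    · intro s _ t _ hst
      exact smul_left_injective F hv (add_left_cancel hst)
  have hcol : ∀ x ∈ P₀, Fintype.card W * #(bipartiteBelow R B x) ≤
      Fintype.card F * Fintype.card (V →ₗ[F] W) := by
    intro x hx
    have hsub : bipartiteBelow R B x ⊆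
        univ.biUnion fun t : F => {M : V →ₗ[F] W | M (x - (a + t • u)) = 0} := by
      intro M hM
      obtain ⟨t, ht⟩ := (mem_filter.1 hM).2
      exact mem_biUnion.2 ⟨t, mem_univ _, by simpa using ht⟩
    calc Fintype.card W * #(bipartiteBelow R B x)
        ≤ Fintype.card W * ∑ t : F, #{M : V →ₗ[F] W | M (x - (a + t • u)) = 0} :=
          Nat.mul_le_mul_left _ ((card_le_card hsub).trans card_biUnion_le)
      _ = ∑ t : F, Fintype.card (V →ₗ[F] W) := by
          rw [mul_sum]
          refine sum_congr rfl fun t _ => ?_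
          rw [mul_comm, card_linearMap_apply_eq_zero]
          exact sub_ne_zero.2 ((mem_filter.1 hx).2 t)
      _ = _ := by simp
  have hdc := sum_card_bipartiteAbove_eq_sum_card_bipartiteBelow (s := B) (t := P₀) R
  calc (Fintype.card F - 1) * Fintype.card W * #B
      = Fintype.card W * ∑ M ∈ B, (Fintype.card F - 1) := by
        rw [sum_const, smul_eq_mul]; ring
    _ ≤ Fintype.card W * ∑ x ∈ P₀, #(bipartiteBelow R B x) := by
        rw [← hdc]; exact Nat.mul_le_mul_left _ (sum_le_sum hrow)
    _ ≤ ∑ x ∈ P₀, Fintype.card F * Fintype.card (V →ₗ[F] W) := by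
        rw [mul_sum]; exact sum_le_sum hcol
    _ ≤ #P * Fintype.card F * Fintype.card (V →ₗ[F] W) := by
        rw [sum_const, smul_eq_mul, mul_assoc]
        exact Nat.mul_le_mul_right _ (card_le_card (filter_subset _ _))

/-- If `P` is small compared to `W`, some linear map to `W` is injective on at least half of the
parametrized lines in `P`. -/
theorem exists_linearMap_injOn_lineParams (P : Finset V) (hW : 4 ≤ Fintype.card W)
    (hP : 8 * #P ≤ Fintype.card W) :
    ∃ (M : V →ₗ[F] W) (T : Finset (V × V)), T ⊆ lineParams F P ∧
      #(lineParams F P) ≤ 2 * #T ∧ Set.InjOn (Prod.map M M) (T : Set (V × V)) := by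
  classical
  have : Finite (V →ₗ[F] W) := DFunLike.finite _
  have := Fintype.ofFinite (V →ₗ[F] W)
  set N := Fintype.card (V →ₗ[F] W) with hN
  let bad : (V →ₗ[F] W) → V × V → Prop := fun M p => M p.2 = 0 ∨ (M p.2 ≠ 0 ∧
    ∃ p' ∈ lineParams F P, p' ≠ p ∧ Prod.map M M p' = Prod.map M M p)
  have hq : 1 < Fintype.card F := Fintype.one_lt_card
  have hgood : ∀ p ∈ lineParams F P, N ≤ 2 * #{M | ¬ bad M p} := by
    intro p hp
    have hp0 := (mem_lineParams.1 hp).1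
    have h₁ : 4 * #{M : V →ₗ[F] W | M p.2 = 0} ≤ N := by
      rw [hN, ← card_linearMap_apply_eq_zero hp0, mul_comm]
      exact Nat.mul_le_mul_left _ hW
    have h₂ := card_collision_le (F := F) (W := W) P hp0
    set b := #{M : V →ₗ[F] W | M p.2 ≠ 0 ∧
        ∃ p' ∈ lineParams F P, p' ≠ p ∧ Prod.map M M p' = Prod.map M M p}
    have h₃ : 4 * b ≤ N := by
      obtain ⟨k, hk⟩ : ∃ k, Fintype.card F = k + 2 := ⟨Fintype.card F - 2, by omega⟩
      rw [hk] at h₂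
      have hWpos : 0 < Fintype.card W := by omega
      refine le_of_mul_le_mul_left ?_ (Nat.mul_pos (Nat.succ_pos k) hWpos)
      have h₄ : 8 * #P * ((k + 2) * N) ≤ Fintype.card W * ((k + 2) * N) :=
        Nat.mul_le_mul_right _ hP
      have h₅ : 0 ≤ Fintype.card W * k * N := Nat.zero_le _
      simp only [show k + 2 - 1 = k + 1 by omega, Nat.succ_eq_add_one] at h₂ ⊢
      nlinarith
    have h₄ : #{M | bad M p} ≤ #{M : V →ₗ[F] W | M p.2 = 0} + b := by
      simp only [bad, filter_or]
      exact card_union_le _ _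
    have h₅ := card_filter_add_card_filter_not (s := (univ : Finset (V →ₗ[F] W)))
      (fun M => bad M p)
    rw [card_univ] at h₅
    omega
  have hdc := sum_card_bipartiteAbove_eq_sum_card_bipartiteBelow
    (s := (univ : Finset (V →ₗ[F] W))) (t := lineParams F P) (fun M p => ¬ bad M p)
  have hsum : ∑ _M : V →ₗ[F] W, #(lineParams F P) ≤
      ∑ M : V →ₗ[F] W, 2 * #(bipartiteAbove (fun M p => ¬ bad M p) (lineParams F P) M) := by
    rw [← mul_sum, hdc, mul_sum, sum_const, card_univ, smul_eq_mul, mul_comm, ← smul_eq_mul,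
      ← sum_const]
    exact sum_le_sum hgood
  obtain ⟨M, -, hM⟩ := exists_le_of_sum_le univ_nonempty hsum
  refine ⟨M, _, filter_subset _ _, hM, ?_⟩
  intro p hp p' hp' h
  simp only [coe_filter, Set.mem_ofPred_eq, bad, not_or] at hp hp'
  by_contra hne
  exact hp.2.2 ⟨hp.2.1, p', hp'.1, Ne.symm hne, h.symm⟩

/-- Distinct lines contained in `P` have disjoint families of parametrizations. -/
theorem ncard_mul_le_card_lineParams (P : Finset V) (L : Set (Set V))
    (hL : ∀ ℓ ∈ L, IsPlane F 1 ℓ) (hP : ∀ ℓ ∈ L, ℓ ⊆ P) :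
    L.ncard * (Fintype.card F * (Fintype.card F - 1)) ≤ #(lineParams F P) := by
  classical
  have hparam : ∀ ℓ : L, ∃ p : V × V, p.2 ≠ 0 ∧
      ∀ x, x ∈ (ℓ : Set V) ↔ ∃ t : F, x = p.1 + t • p.2 := by
    rintro ⟨ℓ, hℓ⟩
    obtain ⟨a, U, hU, rfl⟩ := hL ℓ hℓ
    obtain ⟨u, hu, hspan⟩ := finrank_eq_one_iff'.1 hU
    refine ⟨(a, u), by simpa using hu, fun x => ?_⟩
    simp only [Set.mem_vadd_set, SetLike.mem_coe, vadd_eq_add]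
    constructor
    · rintro ⟨w, hw, rfl⟩
      obtain ⟨c, hc⟩ := hspan ⟨w, hw⟩
      exact ⟨c, congrArg (a + ·) (congrArg Subtype.val hc).symm⟩
    · rintro ⟨t, rfl⟩
      exact ⟨t • u, U.smul_mem t u.2, rfl⟩
  choose p hp0 hp using hparam
  let f : L × F × Fˣ → V × V :=
    fun x => ((p x.1).1 + x.2.1 • (p x.1).2, (x.2.2 : F) • (p x.1).2)
  have hf : ∀ x, f x ∈ lineParams F P := by
    rintro ⟨ℓ, s, r⟩
    refine mem_lineParams.2 ⟨smul_ne_zero r.ne_zero (hp0 ℓ), fun t => ?_⟩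
    refine hP ℓ ℓ.2 ((hp ℓ _).2 ⟨s + t * r, ?_⟩)
    simp only [f]; module
  have hline : ∀ x y, x ∈ (y.1 : Set V) ↔ ∃ t : F, x = (f y).1 + t • (f y).2 := by
    rintro x ⟨ℓ, s, r⟩
    rw [hp]
    constructor
    · rintro ⟨t, rfl⟩
      refine ⟨(t - s) * (r : F)⁻¹, ?_⟩
      simp only [f, smul_smul, mul_assoc, inv_mul_cancel₀ r.ne_zero]
      module
    · rintro ⟨t, rfl⟩
      refine ⟨s + t * r, ?_⟩
      simp only [f]; module
  have hinj : Function.Injective f := by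
    intro x y hxy
    have h₁ : x.1 = y.1 := by
      apply Subtype.ext
      ext z
      rw [hline, hline, hxy]
    obtain ⟨ℓ, s, r⟩ := x
    obtain ⟨ℓ', s', r'⟩ := y
    obtain rfl : ℓ = ℓ' := h₁
    simp only [f, Prod.mk.injEq, add_right_inj] at hxy
    have h₂ := smul_left_injective F (hp0 ℓ) hxy.1
    have h₃ := smul_left_injective F (hp0 ℓ) hxy.2
    simp [h₂, Units.ext h₃]
  have hcard := Finset.card_le_card_of_injOn (s := univ) f (fun x _ => hf x) hinj.injOn
  rwa [card_univ, Fintype.card_prod, Fintype.card_prod, Fintype.card_units,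
    ← Nat.card_eq_fintype_card, Nat.card_coe_set_eq] at hcard

end LineCounting

/-- **Corollary: Wolff's bound at odd integer exponents `α = 2(d-1)+1` holds with no
structural assumption on the collection of lines.** -/
theorem wolff_bound_odd_exponent_no_axiom (d : ℕ) (hd : 1 ≤ d) :
    ∃ c : ℝ, 0 < c ∧
      ∀ (F : Type) [Field F] [Fintype F] (n : ℕ)
        (L : Set (Set (Fin n → F))),
        (∀ ℓ ∈ L, IsPlane F 1 ℓ) →
        (L.ncard : ℝ) ≥ (Fintype.card F : ℝ) ^ (2 * ((d : ℝ) - 1) + 1) →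
        ((⋃₀ L).ncard : ℝ) ≥
          c * (Fintype.card F : ℝ) ^ (((2 * ((d : ℝ) - 1) + 1) + 3) / 2) := by
  refine ⟨1 / 8, by norm_num, ?_⟩
  intro F _ _ n L hL hcard
  classical
  obtain ⟨e, rfl⟩ : ∃ e, d = e + 1 := ⟨d - 1, by omega⟩
  rw [show (2 * (((e + 1 : ℕ) : ℝ) - 1) + 1) = ((2 * e + 1 : ℕ) : ℝ) by push_cast; ring,
    Real.rpow_natCast] at hcard
  rw [show ((2 * (((e + 1 : ℕ) : ℝ) - 1) + 1) + 3) / 2 = ((e + 2 : ℕ) : ℝ) by push_cast; ring,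
    Real.rpow_natCast]
  have hq : 2 ≤ Fintype.card F := Fintype.one_lt_card
  set P : Finset (Fin n → F) := (Set.toFinite (⋃₀ L)).toFinset with hP
  have hPcard : (⋃₀ L).ncard = P.card := Set.ncard_eq_toFinset_card _ _
  rw [hPcard]
  by_contra! hlt
  have hW : Fintype.card (Fin (e + 2) → F) = Fintype.card F ^ (e + 2) := by simp
  have hWR : (Fintype.card (Fin (e + 2) → F) : ℝ) = (Fintype.card F : ℝ) ^ (e + 2) := by
    rw [hW]; push_cast; rfl
  have hW4 : 4 ≤ Fintype.card (Fin (e + 2) → F) := by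
    rw [hW]
    calc 4 = 2 ^ 2 := by norm_num
      _ ≤ Fintype.card F ^ 2 := Nat.pow_le_pow_left hq 2
      _ ≤ _ := Nat.pow_le_pow_right (by omega) (by omega)
  have hP8 : 8 * P.card ≤ Fintype.card (Fin (e + 2) → F) := by
    have : (8 * P.card : ℝ) ≤ Fintype.card (Fin (e + 2) → F) := by rw [hWR]; linarith
    exact_mod_cast this
  have hlines := ncard_mul_le_card_lineParams (F := F) P L hL
    (fun ℓ hℓ => by rw [hP, Set.Finite.coe_toFinset]; exact Set.subset_sUnion_of_mem hℓ)
  obtain ⟨M, T, hTP, hT, hinj⟩ :=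
    exists_linearMap_injOn_lineParams (F := F) (W := Fin (e + 2) → F) P hW4 hP8
  have hvar := card_mul_sq_le_of_line_subset (F := F) (P.image M) (T.image (Prod.map M M)) (by
    intro p hp t
    obtain ⟨p, hpT, rfl⟩ := Finset.mem_image.1 hp
    have := (mem_lineParams.1 (hTP hpT)).2 t
    simpa using Finset.mem_image_of_mem M this)
  rw [Finset.card_image_of_injOn hinj, hWR] at hvar
  have hQ : ((P.image M).card : ℝ) ≤ P.card := by exact_mod_cast Finset.card_image_le
  have hlinesR : (L.ncard : ℝ) * (Fintype.card F * (Fintype.card F - 1)) ≤ 2 * T.card := by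
    have h := hlines.trans hT
    rw [← Nat.cast_le (α := ℝ)] at h
    push_cast [Nat.cast_sub (show 1 ≤ Fintype.card F by omega)] at h
    exact h
  have hqR : (2 : ℝ) ≤ Fintype.card F := by exact_mod_cast hq
  set q : ℝ := (Fintype.card F : ℝ) with hqdef
  set Q : ℝ := ((P.image M).card : ℝ)
  set K : ℝ := q ^ (e + 2) with hK
  have hKpos : 0 < K := by positivity
  have hTlow : K ^ 2 ≤ 4 * (T.card * q) := by
    have h₁ : q ^ (2 * e + 1) * (q * (q / 2)) ≤ L.ncard * (q * (q - 1)) :=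
      mul_le_mul hcard (by nlinarith) (by positivity) (by positivity)
    have h₂ : K ^ 2 = 2 * (q ^ (2 * e + 1) * (q * (q / 2))) * q := by rw [hK]; ring
    rw [h₂]
    nlinarith
  have hgap : (7 / 8 * K) ^ 2 ≤ (K - Q) ^ 2 :=
    pow_le_pow_left₀ (by positivity) (by linarith) 2
  have hfinal : K ^ 2 / 4 * (7 / 8 * K) ^ 2 ≤ K ^ 3 * (1 / 8 * K) :=
    calc K ^ 2 / 4 * (7 / 8 * K) ^ 2 ≤ T.card * q * (K - Q) ^ 2 :=
          mul_le_mul (by linarith) hgap (by positivity) (by positivity)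
      _ ≤ K ^ 3 * Q := hvar
      _ ≤ K ^ 3 * (1 / 8 * K) := mul_le_mul_of_nonneg_left (by linarith) (by positivity)
  have : 0 < K ^ 4 := by positivity
  nlinarith
end
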